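/- There exists a class of languages learnable by a (partial) set-driven strongly monotone explanatory learner that is not learnable by any total partially set-driven monotone explanatory learner: [TxtSdSMonEx] \ [RTxtPsdMonEx] ≠ ∅. -/

import Mathlib

/-- The `e`-th computably enumerable set: the domain of the `e`-th partial
computable function in the standard numbering of `Nat.Partrec.Code`. -/
def Wset (e : ℕ) : Set ℕ := {x | ((Denumerable.ofNat Nat.Partrec.Code e).eval x).Dom}

/-- A text: a function from ℕ to ℕ ∪ {#}, with `none` playing the role of the pause symbol #. -/
def Text := ℕ → Option ℕ

/-- The content of a text: its range without the pause symbol. -/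
def content (T : Text) : Set ℕ := {x | ∃ n, T n = some x}

/-- The initial segment `T[n]` of a text, as a finite sequence over ℕ ∪ {#}. -/
def seg (T : Text) (n : ℕ) : List (Option ℕ) := (List.range n).map T

/-- The content of a finite sequence over ℕ ∪ {#}. -/
def contentSeg (l : List (Option ℕ)) : Set ℕ := {x | (some x) ∈ l}

/-- The content of `T[n]` as a finite set. -/
def fset (T : Text) (n : ℕ) : Finset ℕ := ((List.range n).map T).reduceOption.toFinset

/-- [TxtSdSMonEx]: classes learnable by some partial computable set-driven learner which
is strongly monotone and explanatory on texts of the learned languages. -/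
def TxtSdSMonEx : Set (Set (Set ℕ)) :=
  {𝓛 | ∃ h : Finset ℕ →. ℕ, Partrec h ∧
    ∀ L ∈ 𝓛, ∀ T : Text, content T = L →
      (∃ e : ℕ, Wset e = L ∧ ∃ n₀ : ℕ, ∀ n ≥ n₀, h (fset T n) = Part.some e) ∧
      (∀ i j : ℕ, i ≤ j → ∀ a ∈ h (fset T i), ∀ b ∈ h (fset T j), Wset a ⊆ Wset b)}

/-- [RTxtPsdMonEx]: classes learnable by some total computable partially set-driven
learner which is monotone and explanatory on texts of the learned languages. -/
def RTxtPsdMonEx : Set (Set (Set ℕ)) :=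
  {𝓛 | ∃ h : Finset ℕ × ℕ → ℕ, Computable h ∧
    ∀ L ∈ 𝓛, ∀ T : Text, content T = L →
      (∃ e : ℕ, Wset e = L ∧ ∃ n₀ : ℕ, ∀ n ≥ n₀, h (fset T n, n) = e) ∧
      (∀ i j : ℕ, i ≤ j →
        Wset (h (fset T i, i)) ∩ content T ⊆ Wset (h (fset T j, j)) ∩ content T)}

section

open Denumerable Encodable Nat.Partrec

/-- The strictly increasing list of elements of a finite set of natural numbers. -/
def elems (D : Finset ℕ) : List ℕ := raise' (ofNat (List ℕ) (eqv (Finset ℕ) D)) 0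

theorem mem_elems {D : Finset ℕ} {a : ℕ} : a ∈ elems D ↔ a ∈ D := by
  have h : D = ofNat (Finset ℕ) (eqv (Finset ℕ) D) := (ofNat_encode D).symm
  have h' : ofNat (Finset ℕ) (eqv (Finset ℕ) D) = Finset.map (eqv ℕ).symm.toEmbedding
      (raise'Finset (ofNat (List ℕ) (eqv (Finset ℕ) D)) 0) := rfl
  have h2 : (eqv ℕ).symm.toEmbedding = Function.Embedding.refl ℕ := by
    ext n; rfl
  rw [h2, Finset.map_refl] at h'
  conv_rhs => rw [h, h']
  rfl

theorem raise'_eq_foldl (l : List ℕ) (n : ℕ) (acc : List ℕ) :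
    (l.foldl (fun (s : ℕ × List ℕ) m => (m + s.1 + 1, s.2 ++ [m + s.1])) (n, acc)).2
      = acc ++ raise' l n := by
  induction l generalizing n acc with
  | nil => simp [raise']
  | cons m l ih => simp [raise', ih]

theorem primrec_elems : Primrec elems := by
  have h : Primrec₂ fun (_ : Finset ℕ) (q : (ℕ × List ℕ) × ℕ) =>
      (q.2 + q.1.1 + 1, q.1.2 ++ [q.2 + q.1.1]) := by
    have ha : Primrec fun p : Finset ℕ × ((ℕ × List ℕ) × ℕ) => p.2.2 + p.2.1.1 :=
      Primrec.nat_add.comp (Primrec.snd.comp Primrec.snd)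
        (Primrec.fst.comp (Primrec.fst.comp Primrec.snd))
    exact Primrec.pair (Primrec.succ.comp ha)
      (Primrec.list_concat.comp (Primrec.snd.comp (Primrec.fst.comp Primrec.snd)) ha)
  refine (Primrec.snd.comp (Primrec.list_foldl
    (f := fun D : Finset ℕ => ofNat (List ℕ) (eqv (Finset ℕ) D)) (g := fun _ => (0, []))
    ((Primrec.ofNat _).comp (Primrec.encode (α := Finset ℕ))) (Primrec.const _) h)).of_eq
    fun D => ?_
  exact (raise'_eq_foldl _ 0 []).trans (by simp [elems])

theorem primrecPred_elems_eq : PrimrecPred fun p : List ℕ × Finset ℕ =>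
    (∀ a ∈ p.1, a ∈ elems p.2) ∧ ∀ a ∈ elems p.2, a ∈ p.1 := by
  have hm : PrimrecRel fun (a : ℕ) (l : List ℕ) => a ∈ l := by
    refine PrimrecPred.of_eq (PrimrecPred.comp (f := fun p : ℕ × List ℕ => (p.2, p.1))
      (PrimrecRel.exists_mem_list (Primrec.eq (α := ℕ)))
      (Primrec.pair Primrec.snd Primrec.fst)) fun p => ?_
    simp
  have hs := hm.forall_mem_list
  exact (hs.comp Primrec.fst (primrec_elems.comp Primrec.snd)).and
    (hs.comp (primrec_elems.comp Primrec.snd) Primrec.fst)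

theorem computable_toFinset : Computable (List.toFinset : List ℕ → Finset ℕ) := by
  obtain ⟨inst, hd⟩ := primrecPred_elems_eq
  have h : Partrec fun l : List ℕ => Nat.rfind fun m => Part.some
      (decide ((∀ a ∈ l, a ∈ elems (ofNat (Finset ℕ) m)) ∧
        ∀ a ∈ elems (ofNat (Finset ℕ) m), a ∈ l)) :=
    Partrec.rfind (p := fun (l : List ℕ) (m : ℕ) => Part.some
      (decide ((∀ a ∈ l, a ∈ elems (ofNat (Finset ℕ) m)) ∧
        ∀ a ∈ elems (ofNat (Finset ℕ) m), a ∈ l)))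
      (((hd.comp (Primrec.pair Primrec.fst ((Primrec.ofNat (Finset ℕ)).comp Primrec.snd))).of_eq
        fun p => by simp only; congr).to_comp.partrec)
  refine Partrec.of_eq (h.map ((Computable.ofNat (Finset ℕ)).comp Computable.snd).to₂) fun l => ?_
  refine Part.eq_some_iff.2 ((Part.mem_map_iff _).2
    ⟨eqv (Finset ℕ) l.toFinset, Nat.mem_rfind.2 ⟨?_, fun {m} hm => ?_⟩, ofNat_encode _⟩)
  · have h : ofNat (Finset ℕ) (eqv (Finset ℕ) l.toFinset) = l.toFinset := ofNat_encode _
    simp [mem_elems, h]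
  · refine Part.mem_some_iff.2 (decide_eq_false ?_).symm
    simp only [mem_elems]
    rintro ⟨h1, h2⟩
    have h : l.toFinset = ofNat (Finset ℕ) m := by
      ext a; simp only [List.mem_toFinset]; exact ⟨h1 a, h2 a⟩
    rw [h] at hm
    exact lt_irrefl m (lt_of_lt_of_eq hm ((eqv (Finset ℕ)).apply_symm_apply m))

/-- The position-`s` entry of a sweep through the first `k + 1` columns of block `e`. -/
def sweep (e k s : ℕ) : ℕ := Nat.pair e (Nat.pair (min s.unpair.1 k) (s.unpair.2 + 1))

/-- The first `n` entries of column `i` of block `e`. -/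
def blk (e i n : ℕ) : List ℕ := (List.range n).map fun j => Nat.pair e (Nat.pair i (j + 1))

/-- The list `σ` continued by a sweep through the first `k + 1` columns. -/
def base (e k : ℕ) (σ : List ℕ) (s : ℕ) : List ℕ := σ ++ (List.range (k + s)).map (sweep e k)

/-- The code `e` gives different values after `base e k σ s` and after its extension by an
initial segment of column `k + 1`, where `w` codes `s` and the length of that segment. -/
def differs (p : ℕ × ℕ × List ℕ) (w : ℕ) : Part Bool :=
  ((ofNat Code p.1).eval (encode (base p.1 p.2.1 p.2.2 w.unpair.1 ++
      blk p.1 (p.2.1 + 1) w.unpair.2))).bind fun a =>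
    ((ofNat Code p.1).eval (encode (base p.1 p.2.1 p.2.2 w.unpair.1))).map fun b =>
      !decide (a = b)

/-- The extension of the current list found by searching for a mind change. -/
def next (p : ℕ × ℕ × List ℕ) : Part (List ℕ) :=
  (Nat.rfind (differs p)).map fun w =>
    base p.1 p.2.1 p.2.2 w.unpair.1 ++ blk p.1 (p.2.1 + 1) w.unpair.2

/-- The list reached after `k` mind changes of the learner coded by `e`. -/
def stage (e k : ℕ) : Part (List ℕ) :=
  Nat.rec (Part.some []) (fun y IH => IH.bind fun σ => next (e, y, σ)) k

theorem primrec_base : Primrec fun q : (ℕ × ℕ × List ℕ) × ℕ =>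
    base q.1.1 q.1.2.1 q.1.2.2 q.2.unpair.1 := by
  refine Primrec.list_append.comp (Primrec.snd.comp (Primrec.snd.comp Primrec.fst)) ?_
  refine Primrec.list_map (Primrec.list_range.comp (Primrec.nat_add.comp
    (Primrec.fst.comp (Primrec.snd.comp Primrec.fst))
    (Primrec.fst.comp (Primrec.unpair.comp Primrec.snd)))) ?_
  refine Primrec₂.natPair.comp (Primrec.fst.comp (Primrec.fst.comp Primrec.fst)) ?_
  refine Primrec₂.natPair.comp (Primrec.nat_min.comp
    (Primrec.fst.comp (Primrec.unpair.comp Primrec.snd))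
    (Primrec.fst.comp (Primrec.snd.comp (Primrec.fst.comp Primrec.fst))))
    (Primrec.succ.comp (Primrec.snd.comp (Primrec.unpair.comp Primrec.snd)))

theorem primrec_base_append_blk : Primrec fun q : (ℕ × ℕ × List ℕ) × ℕ =>
    base q.1.1 q.1.2.1 q.1.2.2 q.2.unpair.1 ++ blk q.1.1 (q.1.2.1 + 1) q.2.unpair.2 := by
  refine Primrec.list_append.comp primrec_base ?_
  refine Primrec.list_map (Primrec.list_range.comp
    (Primrec.snd.comp (Primrec.unpair.comp Primrec.snd))) ?_
  exact Primrec₂.natPair.comp (Primrec.fst.comp (Primrec.fst.comp Primrec.fst))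
    (Primrec₂.natPair.comp
      (Primrec.succ.comp (Primrec.fst.comp (Primrec.snd.comp (Primrec.fst.comp Primrec.fst))))
      (Primrec.succ.comp Primrec.snd))

theorem partrec_next : Partrec next := by
  have hc : Computable fun q : (ℕ × ℕ × List ℕ) × ℕ => ofNat Code q.1.1 :=
    (Computable.ofNat Code).comp (Computable.fst.comp Computable.fst)
  have hd : Partrec₂ differs := by
    refine Partrec.bind (Code.eval_part.comp hc
      (Computable.encode.comp primrec_base_append_blk.to_comp)) ?_
    refine Partrec.map (Code.eval_part.comp (hc.comp Computable.fst)
      (Computable.encode.comp (primrec_base.to_comp.comp Computable.fst))) ?_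
    exact (Primrec.not.comp (Primrec.eq.decide.comp
      (Primrec.snd.comp Primrec.fst) Primrec.snd)).to_comp
  exact (Partrec.rfind hd).map primrec_base_append_blk.to_comp

theorem partrec_stage : Partrec₂ stage := by
  refine Partrec.of_eq (Partrec.nat_rec (α := ℕ × ℕ) (f := Prod.snd)
    (g := fun _ => Part.some ([] : List ℕ))
    (h := fun p q => next (p.1, q.1, q.2)) Computable.snd (Computable.const _)
    (partrec_next.comp (Computable.pair (Computable.fst.comp Computable.fst)
      Computable.snd))) fun p => rfl

/-- The block of a coded element. -/
def blockOf (x : ℕ) : ℕ := x.unpair.1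

/-- The column of a coded element. -/
def colOf (x : ℕ) : ℕ := x.unpair.2.unpair.1

/-- The row of a coded element. -/
def rowOf (x : ℕ) : ℕ := x.unpair.2.unpair.2

theorem primrec_blockOf : Primrec blockOf := Primrec.fst.comp Primrec.unpair

theorem primrec_colOf : Primrec colOf :=
  Primrec.fst.comp (Primrec.unpair.comp (Primrec.snd.comp Primrec.unpair))

theorem primrec_rowOf : Primrec rowOf :=
  Primrec.snd.comp (Primrec.unpair.comp (Primrec.snd.comp Primrec.unpair))

@[simp] theorem blockOf_pair (e i j : ℕ) : blockOf (Nat.pair e (Nat.pair i j)) = e := by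
  simp [blockOf]

@[simp] theorem colOf_pair (e i j : ℕ) : colOf (Nat.pair e (Nat.pair i j)) = i := by
  simp [colOf]

@[simp] theorem rowOf_pair (e i j : ℕ) : rowOf (Nat.pair e (Nat.pair i j)) = j := by
  simp [rowOf]

theorem pair_blockOf_colOf_rowOf (x : ℕ) :
    Nat.pair (blockOf x) (Nat.pair (colOf x) (rowOf x)) = x := by
  simp [blockOf, colOf, rowOf]

/-- Semi-decision procedure for the languages of the class, described by a kind `0`, `1` or `2`,
a block and a column. -/
def member (p : (ℕ × ℕ × ℕ) × ℕ) : Part ℕ :=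
  bif decide (blockOf p.2 = p.1.2.1) then
    bif decide (p.1.1 ≠ 1 ∧ colOf p.2 = p.1.2.2 ∧ (rowOf p.2 ≠ 0 ∨ p.1.1 = 2)) then Part.some 0
    else bif decide (p.1.1 ≠ 0 ∧ rowOf p.2 ≠ 0) then
      (stage p.1.2.1 (colOf p.2)).map fun _ => 0
    else Part.none
  else Part.none

theorem partrec_member : Partrec member := by
  have hx : Primrec fun p : (ℕ × ℕ × ℕ) × ℕ => p.2 := Primrec.snd
  have hb : Primrec fun p : (ℕ × ℕ × ℕ) × ℕ => p.1.1 := Primrec.fst.comp Primrec.fst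
  have he : Primrec fun p : (ℕ × ℕ × ℕ) × ℕ => p.1.2.1 :=
    Primrec.fst.comp (Primrec.snd.comp Primrec.fst)
  have hi : Primrec fun p : (ℕ × ℕ × ℕ) × ℕ => p.1.2.2 :=
    Primrec.snd.comp (Primrec.snd.comp Primrec.fst)
  have eqc : ∀ {f g : (ℕ × ℕ × ℕ) × ℕ → ℕ}, Primrec f → Primrec g →
      PrimrecPred fun p => f p = g p := fun hf hg => PrimrecRel.comp Primrec.eq hf hg
  have hr : PrimrecPred fun p : (ℕ × ℕ × ℕ) × ℕ => rowOf p.2 = 0 :=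
    eqc (primrec_rowOf.comp hx) (Primrec.const 0)
  refine Partrec.cond (eqc (primrec_blockOf.comp hx) he).decide.to_comp ?_ Partrec.none
  refine Partrec.cond ((eqc hb (Primrec.const 1)).not.and
    ((eqc (primrec_colOf.comp hx) hi).and
      (hr.not.or (eqc hb (Primrec.const 2))))).decide.to_comp (Computable.const 0).partrec ?_
  refine Partrec.cond ((eqc hb (Primrec.const 0)).not.and hr.not).decide.to_comp
    ?_ Partrec.none
  exact (partrec_stage.comp he.to_comp (primrec_colOf.comp hx).to_comp).map
    (Computable.const 0).to₂

/-- The language described by a kind, a block and a column. -/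
def lang (u : ℕ × ℕ × ℕ) : Set ℕ := {x | (member (u, x)).Dom}

theorem mem_lang_zero {e i x : ℕ} :
    x ∈ lang (0, e, i) ↔ blockOf x = e ∧ colOf x = i ∧ rowOf x ≠ 0 := by
  by_cases h1 : blockOf x = e <;> by_cases h2 : colOf x = i <;> by_cases h3 : rowOf x = 0 <;>
    simp [lang, member, h1, h2, h3]

theorem mem_lang_one {e i x : ℕ} :
    x ∈ lang (1, e, i) ↔ blockOf x = e ∧ rowOf x ≠ 0 ∧ (stage e (colOf x)).Dom := by
  by_cases h1 : blockOf x = e <;> by_cases h3 : rowOf x = 0 <;>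
    simp [lang, member, h1, h3]

theorem mem_lang_two {e i x : ℕ} :
    x ∈ lang (2, e, i) ↔
      blockOf x = e ∧ (colOf x = i ∨ rowOf x ≠ 0 ∧ (stage e (colOf x)).Dom) := by
  by_cases h1 : blockOf x = e <;> by_cases h2 : colOf x = i <;> by_cases h3 : rowOf x = 0 <;>
    simp [lang, member, h1, h2, h3]

theorem stage_zero_dom (e : ℕ) : (stage e 0).Dom := trivial

theorem stage_succ (e k : ℕ) : stage e (k + 1) = (stage e k).bind fun σ => next (e, k, σ) := rfl

theorem stage_dom_of_le {e k l : ℕ} (h : k ≤ l) (hl : (stage e l).Dom) : (stage e k).Dom := by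
  induction h with
  | refl => exact hl
  | step _ ih =>
    rw [stage_succ] at hl
    exact ih (Part.Dom.of_bind hl)

theorem le_foldr_max {l : List ℕ} {a : ℕ} (h : a ∈ l) : a ≤ l.foldr max 0 := by
  induction l with
  | nil => simp at h
  | cons b l ih =>
    rcases List.mem_cons.1 h with rfl | h
    · exact le_max_left _ _
    · exact (ih h).trans (le_max_right _ _)

theorem foldr_max_induction {l : List ℕ} {P : ℕ → Prop} (h0 : P 0) (h : ∀ a ∈ l, P a) :
    P (l.foldr max 0) := by
  induction l with
  | nil => exact h0
  | cons b l ih =>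
    rw [List.foldr_cons]
    rcases max_choice b (l.foldr max 0) with hm | hm <;> rw [hm]
    · exact h b List.mem_cons_self
    · exact ih fun a ha => h a (List.mem_cons_of_mem _ ha)

/-- The largest column met by the set `D`. -/
def maxCol (D : Finset ℕ) : ℕ := ((elems D).map colOf).foldr max 0

/-- The guess of the set-driven learner on a set `D` in which the first element is `a`. -/
def guessFrom (p : Finset ℕ × ℕ) : Part (ℕ × ℕ × ℕ) :=
  bif decide (∃ x ∈ elems p.1, rowOf x = 0) then
    Part.some (2, blockOf p.2, colOf ((elems p.1).filter fun x => rowOf x = 0).headI)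
  else bif decide (∀ x ∈ elems p.1, colOf x = colOf p.2) then
    Part.some (0, blockOf p.2, colOf p.2)
  else (stage (blockOf p.2) (maxCol p.1)).map fun _ => (1, blockOf p.2, 0)

/-- The set-driven learner, with descriptions of languages as hypotheses. -/
def guess (D : Finset ℕ) : Part (ℕ × ℕ × ℕ) :=
  (Part.ofOption (elems D).head?).bind fun a => guessFrom (D, a)

theorem partrec_guessFrom : Partrec guessFrom := by
  have hl : Primrec fun p : Finset ℕ × ℕ => elems p.1 := primrec_elems.comp Primrec.fst
  have hrow : PrimrecPred fun x : ℕ => rowOf x = 0 :=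
    PrimrecRel.comp Primrec.eq primrec_rowOf (Primrec.const 0)
  have hcol : PrimrecRel fun x a : ℕ => colOf x = colOf a :=
    PrimrecRel.comp Primrec.eq (primrec_colOf.comp Primrec.fst) (primrec_colOf.comp Primrec.snd)
  have hb : Primrec fun p : Finset ℕ × ℕ => blockOf p.2 := primrec_blockOf.comp Primrec.snd
  have hm : Primrec fun p : Finset ℕ × ℕ => maxCol p.1 :=
    Primrec.list_foldr (h := fun _ q => max q.1 q.2)
      (Primrec.list_map hl (primrec_colOf.comp Primrec.snd).to₂) (Primrec.const 0)
      (Primrec.nat_max.comp (Primrec.fst.comp Primrec.snd) (Primrec.snd.comp Primrec.snd))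
  refine Partrec.cond (PrimrecPred.decide (hrow.exists_mem_list.comp hl)).to_comp ?_ ?_
  · exact (Primrec.pair (Primrec.const 2) (Primrec.pair hb (primrec_colOf.comp
      (Primrec.list_headI.comp ((Primrec.listFilter hrow).comp hl))))).to_comp.partrec
  refine Partrec.cond (PrimrecPred.decide
    (hcol.forall_mem_list.comp hl Primrec.snd)).to_comp ?_ ?_
  · exact (Primrec.pair (Primrec.const 0)
      (Primrec.pair hb (primrec_colOf.comp Primrec.snd))).to_comp.partrec
  · exact (partrec_stage.comp hb.to_comp hm.to_comp).map
      ((Primrec.pair (Primrec.const 1)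
        (Primrec.pair (hb.comp Primrec.fst) (Primrec.const 0))).to_comp)

theorem partrec_guess : Partrec guess :=
  Partrec.bind (Computable.ofOption (Primrec.list_head?.comp primrec_elems).to_comp)
    partrec_guessFrom

theorem exists_guess_eq {D : Finset ℕ} (hD : D.Nonempty) :
    ∃ a ∈ D, guess D = guessFrom (D, a) := by
  obtain ⟨x, hx⟩ := hD
  rw [← mem_elems] at hx
  cases h : elems D with
  | nil => simp [h] at hx
  | cons a l =>
    refine ⟨a, mem_elems.1 (by simp [h]), ?_⟩
    simp [guess, h]

theorem guess_two {D : Finset ℕ} {e i z : ℕ} (hz : z ∈ D) (hz0 : rowOf z = 0)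
    (hD : ∀ x ∈ D, blockOf x = e ∧ (rowOf x = 0 → colOf x = i)) :
    guess D = Part.some (2, e, i) := by
  obtain ⟨a, ha, h⟩ := exists_guess_eq ⟨z, hz⟩
  have hh : ((elems D).filter fun x => rowOf x = 0).headI ∈
      (elems D).filter fun x => rowOf x = 0 := by
    have hzf : z ∈ (elems D).filter fun x => rowOf x = 0 := by simp [mem_elems, hz, hz0]
    cases hf : (elems D).filter fun x => rowOf x = 0 with
    | nil => simp [hf] at hzf
    | cons b l => simp
  rw [List.mem_filter, mem_elems, decide_eq_true_iff] at hh
  have hex : ∃ x ∈ elems D, rowOf x = 0 := ⟨z, mem_elems.2 hz, hz0⟩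
  rw [h, guessFrom, decide_eq_true hex, cond_true, (hD _ hh.1).2 hh.2, (hD a ha).1]

theorem guess_zero {D : Finset ℕ} {e i : ℕ} (hne : D.Nonempty)
    (hD : ∀ x ∈ D, blockOf x = e ∧ colOf x = i ∧ rowOf x ≠ 0) :
    guess D = Part.some (0, e, i) := by
  obtain ⟨a, ha, h⟩ := exists_guess_eq hne
  have hex : ¬ ∃ x ∈ elems D, rowOf x = 0 := by
    rintro ⟨x, hx, hx0⟩
    exact (hD x (mem_elems.1 hx)).2.2 hx0
  have hall : ∀ x ∈ elems D, colOf x = colOf a := fun x hx => by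
    rw [(hD x (mem_elems.1 hx)).2.1, (hD a ha).2.1]
  rw [h, guessFrom, decide_eq_false hex, cond_false, decide_eq_true hall, cond_true,
    (hD a ha).1, (hD a ha).2.1]

theorem stage_maxCol_dom_iff {D : Finset ℕ} {e : ℕ} :
    (stage e (maxCol D)).Dom ↔ ∀ x ∈ D, (stage e (colOf x)).Dom := by
  constructor
  · intro h x hx
    exact stage_dom_of_le (le_foldr_max (List.mem_map_of_mem (mem_elems.2 hx))) h
  · intro h
    refine foldr_max_induction (P := fun k => (stage e k).Dom) (stage_zero_dom e) fun a ha => ?_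
    obtain ⟨x, hx, rfl⟩ := List.mem_map.1 ha
    exact h x (mem_elems.1 hx)

theorem guess_one {D : Finset ℕ} {e x y : ℕ} (hx : x ∈ D) (hy : y ∈ D)
    (hxy : colOf x ≠ colOf y)
    (hD : ∀ x ∈ D, blockOf x = e ∧ rowOf x ≠ 0 ∧ (stage e (colOf x)).Dom) :
    guess D = Part.some (1, e, 0) := by
  obtain ⟨a, ha, h⟩ := exists_guess_eq ⟨x, hx⟩
  have hex : ¬ ∃ x ∈ elems D, rowOf x = 0 := by
    rintro ⟨x, hx, hx0⟩
    exact (hD x (mem_elems.1 hx)).2.1 hx0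
  have hall : ¬ ∀ x ∈ elems D, colOf x = colOf a := fun hc =>
    hxy ((hc x (mem_elems.2 hx)).trans (hc y (mem_elems.2 hy)).symm)
  have hdom : (stage e (maxCol D)).Dom := stage_maxCol_dom_iff.2 fun x hx => (hD x hx).2.2
  rw [h, guessFrom, decide_eq_false hex, cond_false, decide_eq_false hall, cond_false,
    (hD a ha).1]
  change Part.map _ (stage e (maxCol D)) = _
  rw [← Part.some_get hdom, Part.map_some]

theorem guess_cases {D : Finset ℕ} {e : ℕ} {u : ℕ × ℕ × ℕ} (hD : ∀ x ∈ D, blockOf x = e)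
    (hu : u ∈ guess D) :
    (∃ z ∈ D, rowOf z = 0 ∧ u.1 = 2) ∨
    ((∀ x ∈ D, rowOf x ≠ 0) ∧ ∃ a ∈ D, (∀ x ∈ D, colOf x = colOf a) ∧ u = (0, e, colOf a)) ∨
    ((∀ x ∈ D, rowOf x ≠ 0) ∧ (∃ x ∈ D, ∃ y ∈ D, colOf x ≠ colOf y) ∧
      (∀ x ∈ D, (stage e (colOf x)).Dom) ∧ u = (1, e, 0)) := by
  rcases D.eq_empty_or_nonempty with rfl | hne
  · have h : elems ∅ = [] := List.eq_nil_iff_forall_not_mem.2 fun x hx => by simp [mem_elems] at hx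
    simp [guess, h] at hu
  obtain ⟨a, ha, h⟩ := exists_guess_eq hne
  by_cases hex : ∃ x ∈ elems D, rowOf x = 0
  · obtain ⟨z, hz, hz0⟩ := id hex
    rw [h, guessFrom, decide_eq_true hex, cond_true, Part.mem_some_iff] at hu
    exact Or.inl ⟨z, mem_elems.1 hz, hz0, by rw [hu]⟩
  have hrow : ∀ x ∈ D, rowOf x ≠ 0 := fun x hx hx0 => hex ⟨x, mem_elems.2 hx, hx0⟩
  by_cases hall : ∀ x ∈ elems D, colOf x = colOf a
  · rw [h, guessFrom, decide_eq_false hex, cond_false, decide_eq_true hall, cond_true,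
      Part.mem_some_iff] at hu
    exact Or.inr (Or.inl ⟨hrow, a, ha, fun x hx => hall x (mem_elems.2 hx), by rw [hu, hD a ha]⟩)
  · rw [h, guessFrom, decide_eq_false hex, cond_false, decide_eq_false hall, cond_false,
      Part.mem_map_iff] at hu
    obtain ⟨σ, hσ, rfl⟩ := hu
    simp only [hD a ha] at hσ ⊢
    push Not at hall
    obtain ⟨x, hx, hxa⟩ := hall
    exact Or.inr (Or.inr ⟨hrow, ⟨x, mem_elems.1 hx, a, ha, hxa⟩,
      stage_maxCol_dom_iff.1 (Part.dom_iff_mem.2 ⟨σ, hσ⟩), trivial⟩)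

/-- The class of all languages of kinds `0`, `1` and `2`. -/
def separatingClass : Set (Set ℕ) :=
  {L | ∃ e i, L = lang (0, e, i) ∨ L = lang (1, e, i) ∨ L = lang (2, e, i)}

theorem lang_zero_subset_lang_one {e i : ℕ} (h : (stage e i).Dom) :
    lang (0, e, i) ⊆ lang (1, e, 0) := by
  intro x hx
  rw [mem_lang_zero] at hx
  rw [mem_lang_one]
  obtain ⟨h1, rfl, h3⟩ := hx
  exact ⟨h1, h3, h⟩

theorem lang_one_subset_lang_two {e i j : ℕ} : lang (1, e, i) ⊆ lang (2, e, j) := by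
  intro x hx
  rw [mem_lang_one] at hx
  rw [mem_lang_two]
  exact ⟨hx.1, Or.inr hx.2⟩

theorem lang_zero_subset_lang_two {e i : ℕ} : lang (0, e, i) ⊆ lang (2, e, i) := by
  intro x hx
  rw [mem_lang_zero] at hx
  rw [mem_lang_two]
  exact ⟨hx.1, Or.inl hx.2.1⟩

theorem exists_blockOf_colOf {L : Set ℕ} (hL : L ∈ separatingClass) :
    ∃ e i, ∀ x ∈ L, blockOf x = e ∧ (rowOf x = 0 → colOf x = i ∧ L = lang (2, e, i)) := by
  obtain ⟨e, i, rfl | rfl | rfl⟩ := hL <;> refine ⟨e, i, fun x hx => ?_⟩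
  · rw [mem_lang_zero] at hx
    exact ⟨hx.1, fun h => absurd h hx.2.2⟩
  · rw [mem_lang_one] at hx
    exact ⟨hx.1, fun h => absurd h hx.2.1⟩
  · rw [mem_lang_two] at hx
    exact ⟨hx.1, fun h => ⟨hx.2.resolve_right fun h' => h'.1 h, rfl⟩⟩

theorem lang_subset_of_guess {L : Set ℕ} (hL : L ∈ separatingClass) {D D' : Finset ℕ}
    (hDD' : D ⊆ D') (hD' : (D' : Set ℕ) ⊆ L) {u u' : ℕ × ℕ × ℕ} (hu : u ∈ guess D)
    (hu' : u' ∈ guess D') : lang u ⊆ lang u' := by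
  obtain ⟨e, i, h⟩ := exists_blockOf_colOf hL
  have hb' : ∀ x ∈ D', blockOf x = e := fun x hx => (h x (hD' hx)).1
  have hz' : ∀ {E : Finset ℕ} {z}, E ⊆ D' → z ∈ E → rowOf z = 0 → ∀ {v}, v ∈ guess E →
      v = (2, e, i) := by
    intro E z hE hz hz0 v hv
    rw [guess_two hz hz0 fun x hx => ⟨hb' x (hE hx), fun h0 => ((h x (hD' (hE hx))).2 h0).1⟩,
      Part.mem_some_iff] at hv
    exact hv
  rcases guess_cases hb' hu' with ⟨z, hz, hz0, -⟩ | ⟨hr', a', ha', hc', rfl⟩ |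
      ⟨hr', -, hd', rfl⟩ <;>
    rcases guess_cases (fun x hx => hb' x (hDD' hx)) hu with ⟨y, hy, hy0, -⟩ |
      ⟨hr, a, ha, hc, rfl⟩ | ⟨hr, ⟨x, hx, y, hy, hxy⟩, hd, rfl⟩
  · rw [hz' le_rfl hz hz0 hu', hz' hDD' hy hy0 hu]
  · rw [hz' le_rfl hz hz0 hu']
    have haL := hD' (hDD' ha)
    rw [((h z (hD' hz)).2 hz0).2, mem_lang_two] at haL
    rcases haL.2 with rfl | h2
    · exact lang_zero_subset_lang_two
    · exact (lang_zero_subset_lang_one h2.2).trans lang_one_subset_lang_two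
  · rw [hz' le_rfl hz hz0 hu']
    exact lang_one_subset_lang_two
  · exact absurd hy0 (hr' y (hDD' hy))
  · rw [hc' a (hDD' ha)]
  · exact absurd ((hc' x (hDD' hx)).trans (hc' y (hDD' hy)).symm) hxy
  · exact absurd hy0 (hr' y (hDD' hy))
  · exact lang_zero_subset_lang_one (hd' a (hDD' ha))
  · exact subset_rfl

theorem mem_fset {T : Text} {n a : ℕ} : a ∈ fset T n ↔ ∃ m < n, T m = some a := by
  rw [fset, List.mem_toFinset, List.reduceOption_mem_iff]
  exact List.mem_map.trans (by simp [List.mem_range])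

theorem fset_mono (T : Text) {m n : ℕ} (h : m ≤ n) : fset T m ⊆ fset T n := by
  intro a ha
  rw [mem_fset] at ha ⊢
  obtain ⟨k, hk, hka⟩ := ha
  exact ⟨k, hk.trans_le h, hka⟩

theorem coe_fset_subset_content (T : Text) (n : ℕ) : (fset T n : Set ℕ) ⊆ content T := by
  intro a ha
  obtain ⟨k, -, hka⟩ := mem_fset.1 ha
  exact ⟨k, hka⟩

theorem exists_subset_fset {T : Text} {D : Finset ℕ} (hD : (D : Set ℕ) ⊆ content T) :
    ∃ n₀, ∀ n ≥ n₀, D ⊆ fset T n := by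
  induction D using Finset.induction_on with
  | empty => exact ⟨0, fun n _ => Finset.empty_subset _⟩
  | insert a D _ ih =>
    rw [Finset.coe_insert, Set.insert_subset_iff] at hD
    obtain ⟨n₀, h₀⟩ := ih hD.2
    obtain ⟨m, hm⟩ := hD.1
    refine ⟨max n₀ (m + 1), fun n hn => Finset.insert_subset ?_ (h₀ n (by omega))⟩
    exact mem_fset.2 ⟨m, by omega, hm⟩

/-- Every language of the class has a finite subset beyond which the learner is correct. -/
theorem exists_guess_locking {L : Set ℕ} (hL : L ∈ separatingClass) :
    ∃ u, lang u = L ∧ ∃ D₀ : Finset ℕ, (D₀ : Set ℕ) ⊆ L ∧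
      ∀ D : Finset ℕ, D₀ ⊆ D → (D : Set ℕ) ⊆ L → guess D = Part.some u := by
  have zero : ∀ e i, ∃ u, lang u = lang (0, e, i) ∧ ∃ D₀ : Finset ℕ,
      (D₀ : Set ℕ) ⊆ lang (0, e, i) ∧ ∀ D : Finset ℕ, D₀ ⊆ D → (D : Set ℕ) ⊆ lang (0, e, i) →
        guess D = Part.some u := by
    intro e i
    refine ⟨_, rfl, {Nat.pair e (Nat.pair i 1)}, by simp [mem_lang_zero], fun D h hD => ?_⟩
    exact guess_zero ⟨_, h (Finset.mem_singleton_self _)⟩ fun x hx => mem_lang_zero.1 (hD hx)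
  obtain ⟨e, i, rfl | rfl | rfl⟩ := hL
  · exact zero e i
  · by_cases h1 : (stage e 1).Dom
    · refine ⟨(1, e, 0), by ext x; simp [mem_lang_one],
        {Nat.pair e (Nat.pair 0 1), Nat.pair e (Nat.pair 1 1)}, ?_, fun D h hD => ?_⟩
      · simp [Set.insert_subset_iff, mem_lang_one, h1, stage_zero_dom]
      · exact guess_one (h (Finset.mem_insert_self _ _))
          (h (Finset.mem_insert_of_mem (Finset.mem_singleton_self _))) (by simp)
          fun x hx => mem_lang_one.1 (hD hx)
    · have he : lang (1, e, i) = lang (0, e, 0) := by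
        ext x
        rw [mem_lang_one, mem_lang_zero, and_comm (a := rowOf x ≠ 0)]
        refine and_congr_right fun _ => and_congr_left fun _ => ⟨fun h => ?_, fun h => ?_⟩
        · by_contra hx
          exact h1 (stage_dom_of_le (Nat.one_le_iff_ne_zero.2 hx) h)
        · rw [h]
          exact stage_zero_dom e
      rw [he]
      exact zero e 0
  · refine ⟨_, rfl, {Nat.pair e (Nat.pair i 0)}, by simp [mem_lang_two], fun D h hD => ?_⟩
    refine guess_two (h (Finset.mem_singleton_self _)) (by simp) fun x hx => ?_
    have hx' := mem_lang_two.1 (hD hx)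
    exact ⟨hx'.1, fun h0 => hx'.2.resolve_right fun h2 => h2.1 h0⟩

theorem exists_code_Wset_eq_lang :
    ∃ c : Code, ∀ u : ℕ × ℕ × ℕ, Wset (encode (c.curry (encode u))) = lang u := by
  obtain ⟨c, hc⟩ := Code.exists_code.1 partrec_member
  refine ⟨c, fun u => ?_⟩
  ext x
  have h : Nat.pair (encode u) x = encode (u, x) := rfl
  change ((ofNat Code (encode (c.curry (encode u)))).eval x).Dom ↔ _
  rw [ofNat_encode, Code.eval_curry, hc, h]
  beta_reduce
  rw [encodek, Part.coe_some, Part.bind_some]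
  rfl

theorem separatingClass_mem_TxtSdSMonEx : separatingClass ∈ TxtSdSMonEx := by
  obtain ⟨c, hc⟩ := exists_code_Wset_eq_lang
  refine ⟨fun D => (guess D).map fun u => encode (c.curry (encode u)), ?_, ?_⟩
  · exact partrec_guess.map (Computable.encode.comp (Code.primrec₂_curry.to_comp.comp
      (Computable.const c) (Computable.encode.comp Computable.snd)))
  · rintro L hL T rfl
    constructor
    · obtain ⟨u, hu, D₀, hD₀, h⟩ := exists_guess_locking hL
      obtain ⟨n₀, hn₀⟩ := exists_subset_fset hD₀
      refine ⟨_, (hc u).trans hu, n₀, fun n hn => ?_⟩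
      simp only [h _ (hn₀ n hn) (coe_fset_subset_content T n), Part.map_some]
    · intro i j hij a ha b hb
      obtain ⟨u, hu, rfl⟩ := (Part.mem_map_iff _).1 ha
      obtain ⟨v, hv, rfl⟩ := (Part.mem_map_iff _).1 hb
      rw [hc, hc]
      exact lang_subset_of_guess hL (fset_mono T hij) (coe_fset_subset_content T j) hu hv

theorem fset_length {T : Text} {l : List ℕ} (h : ∀ m (hm : m < l.length), T m = some l[m]) :
    fset T l.length = l.toFinset := by
  ext a
  rw [mem_fset, List.mem_toFinset, List.mem_iff_getElem]
  constructor
  · rintro ⟨m, hm, hma⟩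
    exact ⟨m, hm, Option.some_injective _ ((h m hm).symm.trans hma)⟩
  · rintro ⟨m, hm, rfl⟩
    exact ⟨m, hm, h m hm⟩

/-- The hypothesis of a partially set-driven learner on a sequence without pauses. -/
def hyp (h : Finset ℕ × ℕ → ℕ) (l : List ℕ) : ℕ := h (l.toFinset, l.length)

theorem exists_eval_eq_hyp {h : Finset ℕ × ℕ → ℕ} (hh : Computable h) :
    ∃ e, ∀ l : List ℕ, (ofNat Code e).eval (encode l) = Part.some (hyp h l) := by
  have hc : Computable (hyp h) :=
    hh.comp (Computable.pair computable_toFinset Primrec.list_length.to_comp)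
  obtain ⟨c, hc⟩ := Code.exists_code.1 hc
  refine ⟨encode c, fun l => ?_⟩
  rw [ofNat_encode, hc]
  beta_reduce
  rw [encodek, Part.coe_some, Part.bind_some]
  rfl

section diagonal

variable {h : Finset ℕ × ℕ → ℕ} {e : ℕ}

theorem differs_eq (he : ∀ l : List ℕ, (ofNat Code e).eval (encode l) = Part.some (hyp h l))
    (k : ℕ) (σ : List ℕ) (w : ℕ) :
    differs (e, k, σ) w = Part.some (!decide
      (hyp h (base e k σ w.unpair.1 ++ blk e (k + 1) w.unpair.2) =
        hyp h (base e k σ w.unpair.1))) := by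
  simp only [differs, he, Part.bind_some, Part.map_some]

theorem exists_of_mem_next
    (he : ∀ l : List ℕ, (ofNat Code e).eval (encode l) = Part.some (hyp h l)) {k : ℕ}
    {σ τ : List ℕ} (hτ : τ ∈ next (e, k, σ)) :
    ∃ s n, τ = base e k σ s ++ blk e (k + 1) n ∧ hyp h τ ≠ hyp h (base e k σ s) := by
  obtain ⟨w, hw, rfl⟩ := (Part.mem_map_iff _).1 hτ
  refine ⟨_, _, rfl, ?_⟩
  have hw' := Nat.rfind_spec hw
  rw [differs_eq he, Part.mem_some_iff] at hw'
  simpa using hw'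

theorem next_dom (he : ∀ l : List ℕ, (ofNat Code e).eval (encode l) = Part.some (hyp h l))
    {k : ℕ} {σ : List ℕ} {s n : ℕ}
    (hne : hyp h (base e k σ s ++ blk e (k + 1) n) ≠ hyp h (base e k σ s)) :
    (next (e, k, σ)).Dom := by
  refine (Nat.rfind_dom (p := differs (e, k, σ))).2 ⟨Nat.pair s n, ?_, fun {m} _ => ?_⟩
  · rw [differs_eq he, Part.mem_some_iff]
    simpa using hne
  · rw [differs_eq he]
    trivial

theorem mem_base {k s x : ℕ} {σ : List ℕ} :
    x ∈ base e k σ s ↔ x ∈ σ ∨ ∃ t < k + s, sweep e k t = x := by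
  simp [base]

theorem mem_blk {i n x : ℕ} :
    x ∈ blk e i n ↔ ∃ j < n, Nat.pair e (Nat.pair i (j + 1)) = x := by
  simp [blk]

theorem blockOf_rowOf_colOf_of_mem_stage
    (he : ∀ l : List ℕ, (ofNat Code e).eval (encode l) = Part.some (hyp h l)) {k : ℕ}
    {σ : List ℕ} (hσ : σ ∈ stage e k) :
    ∀ x ∈ σ, blockOf x = e ∧ rowOf x ≠ 0 ∧ colOf x ≤ k := by
  induction k generalizing σ with
  | zero =>
    rw [Part.mem_some_iff.1 hσ]
    simp
  | succ k ih =>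
    rw [stage_succ, Part.mem_bind_iff] at hσ
    obtain ⟨τ, hτ, hσ⟩ := hσ
    obtain ⟨s, n, rfl, -⟩ := exists_of_mem_next he hσ
    intro x hx
    rw [List.mem_append, mem_base, mem_blk] at hx
    rcases hx with (hx | ⟨t, -, rfl⟩) | ⟨j, -, rfl⟩
    · obtain ⟨h1, h2, h3⟩ := ih hτ x hx
      exact ⟨h1, h2, h3.trans k.le_succ⟩
    · simp [sweep]
    · simp

theorem sweep_eq {k x : ℕ} (hb : blockOf x = e) (hr : rowOf x ≠ 0) (hc : colOf x ≤ k) :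
    sweep e k (Nat.pair (colOf x) (rowOf x - 1)) = x := by
  rw [sweep, Nat.unpair_pair, min_eq_left hc, Nat.sub_add_cancel (Nat.pos_of_ne_zero hr), ← hb]
  exact pair_blockOf_colOf_rowOf x

/-- A learner converging on all texts of `lang (1, e, 0)` makes the construction stop: otherwise
the limit of the stages is a text on which it changes its mind infinitely often. -/
theorem exists_stage_not_dom
    (he : ∀ l : List ℕ, (ofNat Code e).eval (encode l) = Part.some (hyp h l))
    (hL : ∀ T : Text, content T = lang (1, e, 0) →
      ∃ a, ∃ n₀ : ℕ, ∀ n ≥ n₀, h (fset T n, n) = a) :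
    ∃ k, (stage e k).Dom ∧ ¬ (stage e (k + 1)).Dom := by
  by_contra! hnot
  have hdom : ∀ k, (stage e k).Dom := fun k => by
    induction k with
    | zero => exact stage_zero_dom e
    | succ k ih => exact hnot k ih
  choose σ hσ using fun k => Part.dom_iff_mem.1 (hdom k)
  have hstep : ∀ k, ∃ s n, σ (k + 1) = base e k (σ k) s ++ blk e (k + 1) n ∧
      hyp h (σ (k + 1)) ≠ hyp h (base e k (σ k) s) := fun k => by
    have hk := hσ (k + 1)
    rw [stage_succ, Part.mem_bind_iff] at hk
    obtain ⟨τ, hτ, hk⟩ := hk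
    rw [Part.mem_unique hτ (hσ k)] at hk
    exact exists_of_mem_next he hk
  choose s n hsn hne using hstep
  have hpre : ∀ k, σ k <+: σ (k + 1) := fun k => by
    rw [hsn k, base, List.append_assoc]
    exact List.prefix_append _ _
  have hmono : ∀ k l, k ≤ l → σ k <+: σ l := by
    intro k l hkl
    induction hkl with
    | refl => exact List.prefix_rfl
    | step _ ih => exact ih.trans (hpre _)
  have hlen : ∀ k, k ≤ (σ k).length := fun k => by
    induction k with
    | zero => exact Nat.zero_le _
    | succ k ih =>
      refine Nat.succ_le_of_lt (ih.trans_lt (lt_of_le_of_ne (hpre k).length_le fun hl => ?_))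
      have hk := (hpre k).eq_of_length hl
      have hb : base e k (σ k) (s k) <+: σ k := by
        conv_rhs => rw [hk, hsn k]
        exact List.prefix_append _ _
      have hb' : base e k (σ k) (s k) = σ k :=
        hb.eq_of_length (le_antisymm hb.length_le (by simp [base]))
      exact hne k (by rw [hb', ← hk])
  let T : Text := fun m => (σ (m + 1))[m]?
  have hT : ∀ k l, l <+: σ k → ∀ m (hm : m < l.length), T m = some l[m] := by
    intro k l hl m hm
    have h1 : m < (σ (m + 1)).length := hlen (m + 1)
    change (σ (m + 1))[m]? = _
    rw [List.getElem?_eq_getElem h1, (hmono _ _ (le_max_left (m + 1) k)).getElem h1,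
      (hl.trans (hmono _ _ (le_max_right (m + 1) k))).getElem hm]
  have hcontent : content T = lang (1, e, 0) := by
    ext x
    rw [mem_lang_one]
    constructor
    · rintro ⟨m, hm⟩
      obtain ⟨h1, h2, -⟩ := blockOf_rowOf_colOf_of_mem_stage he (hσ (m + 1)) x
        (List.mem_of_getElem? hm)
      exact ⟨h1, h2, hdom _⟩
    · rintro ⟨hb, hr, -⟩
      let t := Nat.pair (colOf x) (rowOf x - 1)
      let k := max (colOf x) (t + 1)
      have hx : x ∈ σ (k + 1) := by
        rw [hsn k]
        refine List.mem_append_left _ (mem_base.2 (Or.inr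
          ⟨t, ?_, sweep_eq hb hr (le_max_left _ _)⟩))
        have : t + 1 ≤ k := le_max_right _ _
        omega
      obtain ⟨m, hm, hmx⟩ := List.mem_iff_getElem.1 hx
      exact ⟨m, (hT (k + 1) _ List.prefix_rfl m hm).trans (congrArg some hmx)⟩
  obtain ⟨a, n₀, hn₀⟩ := hL T hcontent
  have hval : ∀ k l, l <+: σ k → n₀ ≤ l.length → hyp h l = a := fun k l hl hlen => by
    rw [hyp, ← fset_length (hT k l hl)]
    exact hn₀ _ hlen
  have hb : base e n₀ (σ n₀) (s n₀) <+: σ (n₀ + 1) := by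
    rw [hsn n₀]
    exact List.prefix_append _ _
  refine hne n₀ ((hval _ _ List.prefix_rfl ((hlen (n₀ + 1)).trans' n₀.le_succ)).trans
    (hval _ _ hb ?_).symm)
  rw [base, List.length_append]
  exact (hlen n₀).trans (Nat.le_add_right _ _)

/-- A list followed by an infinite sequence of elements and pauses. -/
def continued (l : List ℕ) (S : Text) : Text :=
  fun m => if hm : m < l.length then some l[m] else S (m - l.length)

theorem continued_of_lt {l : List ℕ} (S : Text) {m : ℕ} (hm : m < l.length) :
    continued l S m = some l[m] :=
  dif_pos hm

theorem continued_of_le {l : List ℕ} (S : Text) {m : ℕ} (hm : l.length ≤ m) :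
    continued l S m = S (m - l.length) :=
  dif_neg hm.not_gt

theorem continued_apply {l l' : List ℕ} (hl : l' <+: l) (S : Text) (m : ℕ)
    (hm : m < l'.length) : continued l S m = some l'[m] := by
  rw [continued_of_lt S (hm.trans_le hl.length_le), hl.getElem hm]

theorem fset_continued {l l' : List ℕ} (hl : l' <+: l) (S : Text) :
    fset (continued l S) l'.length = l'.toFinset :=
  fset_length (continued_apply hl S)

theorem content_continued (l : List ℕ) (S : Text) :
    content (continued l S) = {x | x ∈ l} ∪ content S := by
  ext x
  constructor
  · rintro ⟨m, hm⟩
    by_cases hml : m < l.length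
    · rw [continued_of_lt S hml] at hm
      exact Or.inl (Option.some_injective _ hm ▸ List.getElem_mem hml)
    · rw [continued_of_le S (not_lt.1 hml)] at hm
      exact Or.inr ⟨_, hm⟩
  · rintro (hx | ⟨m, hm⟩)
    · obtain ⟨m, hm, rfl⟩ := List.mem_iff_getElem.1 hx
      exact ⟨m, continued_of_lt S hm⟩
    · refine ⟨l.length + m, ?_⟩
      rw [continued_of_le S (Nat.le_add_right _ _), Nat.add_sub_cancel_left]
      exact hm

/-- The text without pauses listing the values of `f`. -/
def listing (f : ℕ → ℕ) : Text := fun m => some (f m)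

theorem content_listing (f : ℕ → ℕ) : content (listing f) = Set.range f :=
  Set.ext fun _ => exists_congr fun _ => (Option.some_injective ℕ).eq_iff

theorem fset_continued_listing (σ : List ℕ) (f : ℕ → ℕ) (n : ℕ) :
    fset (continued σ (listing f)) (σ ++ (List.range n).map f).length =
      (σ ++ (List.range n).map f).toFinset := by
  refine fset_length fun m hm => ?_
  by_cases hml : m < σ.length
  · rw [continued_of_lt _ hml, List.getElem_append_left hml]
  · rw [continued_of_le _ (not_lt.1 hml), List.getElem_append_right (not_lt.1 hml)]
    simp [listing]

theorem exists_text (L : Set ℕ) : ∃ S : Text, content S = L := by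
  classical
  refine ⟨fun m => if m ∈ L then some m else none, ?_⟩
  ext x
  simp [content]

theorem separatingClass_notMem_RTxtPsdMonEx : separatingClass ∉ RTxtPsdMonEx := by
  rintro ⟨h, hh, hL⟩
  obtain ⟨e, he⟩ := exists_eval_eq_hyp hh
  have h0 : ∀ i, lang (0, e, i) ∈ separatingClass := fun i => ⟨e, i, Or.inl rfl⟩
  have h1 : lang (1, e, 0) ∈ separatingClass := ⟨e, 0, Or.inr (Or.inl rfl)⟩
  have h2 : ∀ i, lang (2, e, i) ∈ separatingClass := fun i => ⟨e, i, Or.inr (Or.inr rfl)⟩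
  obtain ⟨k, hk, hk'⟩ := exists_stage_not_dom he fun T hT => by
    obtain ⟨⟨a, -, ha⟩, -⟩ := hL _ h1 T hT
    exact ⟨a, ha⟩
  obtain ⟨σ, hσ⟩ := Part.dom_iff_mem.1 hk
  have hσL : ∀ x ∈ σ, x ∈ lang (1, e, 0) := fun x hx => by
    obtain ⟨hb, hr, hc⟩ := blockOf_rowOf_colOf_of_mem_stage he hσ x hx
    exact mem_lang_one.2 ⟨hb, hr, stage_dom_of_le hc hk⟩
  have hsweep : ∀ t, sweep e k t ∈ lang (1, e, 0) := fun t => by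
    rw [mem_lang_one, sweep, blockOf_pair, rowOf_pair, colOf_pair]
    exact ⟨rfl, Nat.succ_ne_zero _, stage_dom_of_le (min_le_right _ _) hk⟩
  have hlock : ∀ s n, hyp h (base e k σ s ++ blk e (k + 1) n) = hyp h (base e k σ s) := by
    intro s n
    by_contra hne
    refine hk' ?_
    rw [stage_succ, Part.eq_some_iff.2 hσ, Part.bind_some]
    exact next_dom he hne
  obtain ⟨n, hn⟩ : ∃ n, Wset (hyp h (blk e (k + 1) n)) = lang (0, e, k + 1) := by
    let f : ℕ → ℕ := fun j => Nat.pair e (Nat.pair (k + 1) (j + 1))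
    obtain ⟨⟨a, ha, n, hn⟩, -⟩ := hL _ (h0 (k + 1)) (continued [] (listing f)) (by
      rw [content_continued, content_listing]
      ext x
      rw [mem_lang_zero]
      constructor
      · rintro (hx | ⟨m, rfl⟩)
        · simp at hx
        · simp [f]
      · rintro ⟨hb, hc, hr⟩
        refine Or.inr ⟨rowOf x - 1, ?_⟩
        simp only [f]
        rw [Nat.sub_add_cancel (Nat.pos_of_ne_zero hr), ← hb, ← hc]
        exact pair_blockOf_colOf_rowOf x)
    refine ⟨n, Eq.trans (congrArg Wset ?_) ha⟩
    have hf := fset_continued_listing [] f n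
    rw [List.nil_append] at hf
    change h ((blk e (k + 1) n).toFinset, (blk e (k + 1) n).length) = a
    change _ = (blk e (k + 1) n).toFinset at hf
    rw [← hf]
    exact hn _ (by simp)
  obtain ⟨s, hs⟩ : ∃ s, Wset (hyp h (base e k σ s)) = lang (1, e, 0) := by
    obtain ⟨⟨a, ha, n, hn⟩, -⟩ := hL _ h1 (continued σ (listing (sweep e k))) (by
      rw [content_continued, content_listing]
      ext x
      constructor
      · rintro (hx | ⟨m, rfl⟩)
        · exact hσL x hx
        · exact hsweep m
      · intro hx
        obtain ⟨hb, hr, hd⟩ := mem_lang_one.1 hx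
        refine Or.inr ⟨_, sweep_eq hb hr ?_⟩
        by_contra hc
        exact hk' (stage_dom_of_le (not_le.1 hc) hd))
    refine ⟨n, Eq.trans (congrArg Wset ?_) ha⟩
    have hf := fset_continued_listing σ (sweep e k) (k + n)
    rw [hyp, base, ← hf]
    exact hn _ (by simp; omega)
  obtain ⟨S, hS⟩ := exists_text (lang (2, e, k + 1))
  have hT : content (continued (blk e (k + 1) n ++ base e k σ s) S) = lang (2, e, k + 1) := by
    rw [content_continued, hS, Set.union_eq_right]
    intro x hx
    rcases List.mem_append.1 hx with hx | hx
    · obtain ⟨j, -, rfl⟩ := mem_blk.1 hx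
      simp [mem_lang_two]
    · refine lang_one_subset_lang_two (i := 0) ?_
      rcases mem_base.1 hx with hx | ⟨t, -, rfl⟩
      · exact hσL x hx
      · exact hsweep t
  have hmon := (hL _ (h2 (k + 1)) _ hT).2 (blk e (k + 1) n).length
    (blk e (k + 1) n ++ base e k σ s).length (by simp)
  rw [fset_continued (List.prefix_append _ _), fset_continued List.prefix_rfl, hT] at hmon
  have hswap : hyp h (blk e (k + 1) n ++ base e k σ s) = hyp h (base e k σ s) := by
    rw [← hlock s n, hyp, hyp]
    congr 2
    · ext x
      simp [or_comm]
    · simp [add_comm]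
  change Wset (hyp h _) ∩ _ ⊆ Wset (hyp h _) ∩ _ at hmon
  rw [hswap, hn, hs] at hmon
  have hy : Nat.pair e (Nat.pair (k + 1) 1) ∈ lang (1, e, 0) :=
    (hmon ⟨by simp [mem_lang_zero], by simp [mem_lang_two]⟩).1
  rw [mem_lang_one, colOf_pair] at hy
  exact hk' hy.2.2

end diagonal

end

/-- [TxtSdSMonEx] \ [RTxtPsdMonEx] ≠ ∅. -/
theorem TxtSdSMonEx_not_sub_RTxtPsdMonEx :
    ∃ 𝓛 : Set (Set ℕ), 𝓛 ∈ TxtSdSMonEx ∧ 𝓛 ∉ RTxtPsdMonEx :=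
  ⟨separatingClass, separatingClass_mem_TxtSdSMonEx, separatingClass_notMem_RTxtPsdMonEx⟩
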